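/- arXiv:1612.07589 — 7 statements merged into one kernel-verified Lean document; each statement's English description precedes it below -/
import Mathlib

section
/- Correctness of Algorithm 1 (main theorem, maximization): for any finite family F of finsets of α and any R : Finset α, the union over all n ∈ ℕ of Cardmax R F_n, where (F_n) is the maximization iteration of Algorithm 1 starting from F, equals Setmax R F. -/
/-- Subset-maximal solutions of a family `F` of finsets, relative to `R`. -/
def Setmax {α : Type*} [DecidableEq α] (R : Finset α) (F : Set (Finset α)) :
    Set (Finset α) :=
  {s ∈ F | ¬ ∃ s' ∈ F, s ∩ R ⊂ s' ∩ R}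

/-- Cardinality-maximal solutions of a family `F` of finsets, relative to `R`. -/
def Cardmax {α : Type*} [DecidableEq α] (R : Finset α) (F : Set (Finset α)) :
    Set (Finset α) :=
  {s ∈ F | ∀ s' ∈ F, (s' ∩ R).card ≤ (s ∩ R).card}

/-- The maximization iteration of Algorithm 1 starting from `F`:
`F_0 = F` and `F_{n+1}` consists of those members of `F_n` whose restriction to
`R` is not contained in the restriction of any cardinality-maximal member of `F_n`. -/
def iterMax {α : Type*} [DecidableEq α] (R : Finset α) (F : Set (Finset α)) :
    ℕ → Set (Finset α)
  | 0 => F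
  | n + 1 =>
      {s' ∈ iterMax R F n | ¬ ∃ s ∈ Cardmax R (iterMax R F n), s' ∩ R ⊆ s ∩ R}

theorem iterMax_sub {α : Type*} [DecidableEq α] (R : Finset α) (F : Set (Finset α)) (n : ℕ) :
    iterMax R F n ⊆ F := by
  induction n with
  | zero => exact fun _ h => h
  | succ n ih => exact fun _ h => ih h.1

theorem iterMax_up {α : Type*} [DecidableEq α] (R : Finset α) (F : Set (Finset α))
    {s t : Finset α} (ht : t ∈ F) (hst : s ∩ R ⊆ t ∩ R) (n : ℕ)
    (hs : s ∈ iterMax R F n) : t ∈ iterMax R F n := by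
  induction n with
  | zero => exact ht
  | succ n ih =>
    refine ⟨ih hs.1, ?_⟩
    rintro ⟨u, hu, htu⟩
    exact hs.2 ⟨u, hu, hst.trans htu⟩

theorem iterMax_card {α : Type*} [DecidableEq α] (R : Finset α) (F : Set (Finset α))
    (hF : F.Finite) (n : ℕ) : ∀ t ∈ iterMax R F n, (t ∩ R).card + n ≤ R.card := by
  induction n with
  | zero => exact fun t _ => Finset.card_le_card Finset.inter_subset_right
  | succ n ih =>
    intro t ht
    obtain ⟨m, hm, hmax⟩ := Set.exists_max_image (iterMax R F n)
      (fun s => (s ∩ R).card) (hF.subset (iterMax_sub R F n)) ⟨t, ht.1⟩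
    have h1 := ih m hm
    have h2 : (t ∩ R).card < (m ∩ R).card := by
      by_contra h
      exact ht.2 ⟨t, ⟨ht.1, fun u hu => (hmax u hu).trans (not_lt.mp h)⟩, subset_rfl⟩
    omega

/-- Correctness of Algorithm 1 (maximization): for a finite family `F`, the union
over all iterations of the cardinality-maximal solutions equals the set of
subset-maximal solutions of `F`. -/
theorem iterMax_union_cardmax_eq_setmax {α : Type*} [DecidableEq α]
    (R : Finset α) (F : Set (Finset α)) (hF : F.Finite) :
    (⋃ n : ℕ, Cardmax R (iterMax R F n)) = Setmax R F := by
  ext s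
  rw [Set.mem_iUnion]
  constructor
  · rintro ⟨n, hs, hmax⟩
    refine ⟨iterMax_sub R F n hs, ?_⟩
    rintro ⟨t, ht, hst⟩
    exact absurd (Finset.card_lt_card hst) (not_lt.mpr (hmax t (iterMax_up R F ht hst.1 n hs)))
  · rintro ⟨hs, hmax⟩
    by_contra hno
    have key : ∀ n, s ∈ iterMax R F n := by
      intro n
      induction n with
      | zero => exact hs
      | succ n ih =>
        refine ⟨ih, ?_⟩
        rintro ⟨t, ht, hst⟩
        rcases hst.eq_or_ssubset with h | h
        · refine hno ⟨n, ih, fun u hu => ?_⟩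
          rw [h]
          exact ht.2 u hu
        · exact hmax ⟨t, iterMax_sub R F n ht.1, h⟩
    have := iterMax_card R F hF (R.card + 1) s (key _)
    omega
end

section
/- Correctness of the minimization variant of Algorithm 1: for any finite family F of finsets of α and any R : Finset α, the union over all n ∈ ℕ of Cardmin R G_n, where (G_n) is the minimization iteration starting from F, equals Setmin R F. -/
/-- Subset-minimal solutions of a family `F` of finsets, relative to `R`. -/
def Setmin {α : Type*} [DecidableEq α] (R : Finset α) (F : Set (Finset α)) :
    Set (Finset α) :=
  {s ∈ F | ¬ ∃ s' ∈ F, s' ∩ R ⊂ s ∩ R}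

/-- Cardinality-minimal solutions of a family `F` of finsets, relative to `R`. -/
def Cardmin {α : Type*} [DecidableEq α] (R : Finset α) (F : Set (Finset α)) :
    Set (Finset α) :=
  {s ∈ F | ∀ s' ∈ F, (s ∩ R).card ≤ (s' ∩ R).card}

/-- The minimization iteration of Algorithm 1 starting from `F`:
`G_0 = F` and `G_{n+1}` consists of those members of `G_n` whose restriction to
`R` does not contain the restriction of any cardinality-minimal member of `G_n`. -/
def iterMin {α : Type*} [DecidableEq α] (R : Finset α) (F : Set (Finset α)) :
    ℕ → Set (Finset α)
  | 0 => F
  | n + 1 =>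
      {s' ∈ iterMin R F n | ¬ ∃ s ∈ Cardmin R (iterMin R F n), s ∩ R ⊆ s' ∩ R}

theorem iterMin_sub_aux {α : Type*} [DecidableEq α]
    (R : Finset α) (F : Set (Finset α)) (n : ℕ) : iterMin R F n ⊆ F := by
  induction n with
  | zero => exact fun _ h => h
  | succ n ih => exact fun _ h => ih h.1

theorem iterMin_down_aux {α : Type*} [DecidableEq α]
    (R : Finset α) (F : Set (Finset α)) (n : ℕ) :
    ∀ s ∈ iterMin R F n, ∀ s' ∈ F, s' ∩ R ⊆ s ∩ R → s' ∈ iterMin R F n := by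
  induction n with
  | zero => exact fun _ _ _ h _ => h
  | succ n ih =>
    intro s hs s' hs' hsub
    exact ⟨ih s hs.1 s' hs' hsub, fun ⟨t, ht, hts⟩ => hs.2 ⟨t, ht, hts.trans hsub⟩⟩

theorem iterMin_card_aux {α : Type*} [DecidableEq α]
    (R : Finset α) (F : Set (Finset α)) (n : ℕ) :
    ∀ s ∈ iterMin R F n, n ≤ (s ∩ R).card := by
  induction n with
  | zero => exact fun _ _ => Nat.zero_le _
  | succ n ih =>
    intro s hs
    by_contra hlt
    refine hs.2 ⟨s, ⟨hs.1, fun t ht => ?_⟩, subset_rfl⟩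
    have := ih t ht
    omega

/-- Correctness of the minimization variant of Algorithm 1: for a finite family `F`,
the union over all iterations of the cardinality-minimal solutions equals the set of
subset-minimal solutions of `F`. -/
theorem iterMin_union_cardmin_eq_setmin {α : Type*} [DecidableEq α]
    (R : Finset α) (F : Set (Finset α)) (hF : F.Finite) :
    (⋃ n : ℕ, Cardmin R (iterMin R F n)) = Setmin R F := by
  ext s
  simp only [Set.mem_iUnion]
  constructor
  · rintro ⟨n, hs, hmin⟩
    refine ⟨iterMin_sub_aux R F n hs, ?_⟩
    rintro ⟨t, ht, hts⟩
    have h1 := hmin t (iterMin_down_aux R F n s hs t ht hts.1)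
    have h2 := Finset.card_lt_card hts
    omega
  · rintro ⟨hs, hmin⟩
    by_contra hno
    have key : ∀ n, s ∈ iterMin R F n := by
      intro n
      induction n with
      | zero => exact hs
      | succ n ih =>
        refine ⟨ih, ?_⟩
        rintro ⟨t, ht, hts⟩
        have heq : t ∩ R = s ∩ R := by
          by_contra hne
          exact hmin ⟨t, iterMin_sub_aux R F n ht.1, Finset.ssubset_iff_subset_ne.2 ⟨hts, hne⟩⟩
        exact hno ⟨n, ih, fun u hu => heq ▸ ht.2 u hu⟩
    have := iterMin_card_aux R F _ s (key ((s ∩ R).card + 1))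
    omega
end

section
/- Level-by-level characterization of Algorithm 1's outputs: for any finite family F of finsets of α, any R : Finset α, every n ∈ ℕ, and every finset s, one has s ∈ Cardmax R F_n if and only if s ∈ Setmax R F and the number of distinct values in {(t ∩ R).card | t ∈ Setmax R F} that are strictly greater than (s ∩ R).card equals n; that is, the n-th iteration outputs exactly the subset-maximal solutions whose restricted cardinality is the (n+1)-st largest restricted cardinality occurring among subset-maximal solutions. -/
def stepMax {α : Type*} [DecidableEq α] (R : Finset α) (F : Set (Finset α)) :
    Set (Finset α) :=
  {s' ∈ F | ¬ ∃ s ∈ Cardmax R F, s' ∩ R ⊆ s ∩ R}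

lemma iterMax_succ_step {α : Type*} [DecidableEq α] (R : Finset α) (F : Set (Finset α)) (n : ℕ) :
    iterMax R F (n + 1) = iterMax R (stepMax R F) n := by
  induction n with
  | zero => rfl
  | succ n ih =>
    rw [iterMax, ih]
    rfl

lemma setmax_step {α : Type*} [DecidableEq α] (R : Finset α) (F : Set (Finset α))
    (s : Finset α) :
    s ∈ Setmax R (stepMax R F) ↔ s ∈ Setmax R F ∧ s ∉ Cardmax R F := by
  constructor
  · rintro ⟨⟨hsF, hs⟩, hmax⟩
    refine ⟨⟨hsF, ?_⟩, fun h => hs ⟨s, h, subset_rfl⟩⟩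
    rintro ⟨s', hs', hlt⟩
    refine hmax ⟨s', ⟨hs', ?_⟩, hlt⟩
    rintro ⟨t, ht, hst⟩
    exact hs ⟨t, ht, hlt.subset.trans hst⟩
  · rintro ⟨⟨hsF, hmax⟩, hc⟩
    refine ⟨⟨hsF, ?_⟩, fun ⟨s', hs', hlt⟩ => hmax ⟨s', hs'.1, hlt⟩⟩
    rintro ⟨t, ht, hst⟩
    rcases hst.eq_or_ssubset with h | h
    · exact hc ⟨hsF, by rw [h]; exact ht.2⟩
    · exact hmax ⟨t, ht.1, h⟩

lemma cardmax_setmax {α : Type*} [DecidableEq α] (R : Finset α) (F : Set (Finset α))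
    (s : Finset α) (h : s ∈ Cardmax R F) : s ∈ Setmax R F :=
  ⟨h.1, fun ⟨s', hs', hlt⟩ => absurd (Finset.card_lt_card hlt) (not_lt.2 (h.2 s' hs'))⟩

lemma count_of_cardmax {α : Type*} [DecidableEq α] (R : Finset α) (F : Set (Finset α))
    (s : Finset α) (h : s ∈ Cardmax R F) :
    {k ∈ (fun t => (t ∩ R).card) '' Setmax R F | (s ∩ R).card < k} = ∅ := by
  ext k
  simp only [Set.mem_ofPred_eq, Set.mem_empty_iff_false, iff_false]
  rintro ⟨⟨t, ht, rfl⟩, hlt⟩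
  exact absurd hlt (not_lt.2 (h.2 t ht.1))

lemma cardmax_exists {α : Type*} [DecidableEq α] (R : Finset α) (F : Set (Finset α))
    (hF : F.Finite) (s : Finset α) (h : s ∈ F) : ∃ t, t ∈ Cardmax R F := by
  obtain ⟨t, ht, h'⟩ := Set.exists_max_image F (fun t => (t ∩ R).card) hF ⟨s, h⟩
  exact ⟨t, ht, h'⟩

lemma count_step {α : Type*} [DecidableEq α] (R : Finset α) (F : Set (Finset α))
    (hF : F.Finite) (s : Finset α) (h : s ∈ Setmax R F) (hc : s ∉ Cardmax R F) :
    {k ∈ (fun t => (t ∩ R).card) '' Setmax R F | (s ∩ R).card < k}.ncard =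
    {k ∈ (fun t => (t ∩ R).card) '' Setmax R (stepMax R F) | (s ∩ R).card < k}.ncard + 1 := by
  obtain ⟨m, hm⟩ := cardmax_exists R F hF s h.1
  have key : ∀ t ∈ F, (t ∩ R).card = (m ∩ R).card → t ∈ Cardmax R F := by
    intro t ht he
    exact ⟨ht, by rw [he]; exact hm.2⟩
  have e : {k ∈ (fun t => (t ∩ R).card) '' Setmax R F | (s ∩ R).card < k} =
      insert (m ∩ R).card
        {k ∈ (fun t => (t ∩ R).card) '' Setmax R (stepMax R F) | (s ∩ R).card < k} := by
    ext k
    simp only [Set.mem_ofPred_eq, Set.mem_insert_iff]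
    constructor
    · rintro ⟨⟨t, ht, rfl⟩, hlt⟩
      by_cases htc : t ∈ Cardmax R F
      · exact Or.inl (le_antisymm (hm.2 t ht.1) (htc.2 m hm.1))
      · exact Or.inr ⟨⟨t, (setmax_step R F t).2 ⟨ht, htc⟩, rfl⟩, hlt⟩
    · rintro (rfl | ⟨⟨t, ht, rfl⟩, hlt⟩)
      · exact ⟨⟨m, cardmax_setmax R F m hm, rfl⟩,
          lt_of_le_of_ne (hm.2 s h.1) fun he => hc (key s h.1 he)⟩
      · exact ⟨⟨t, ((setmax_step R F t).1 ht).1, rfl⟩, hlt⟩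
  have hfin : {k ∈ (fun t => (t ∩ R).card) '' Setmax R (stepMax R F) | (s ∩ R).card < k}.Finite :=
    ((hF.subset fun t ht => ht.1.1).image _).subset fun k hk => hk.1
  rw [e, Set.ncard_insert_of_notMem _ hfin]
  · rintro ⟨⟨t, ht, he⟩, -⟩
    have := (setmax_step R F t).1 ht
    exact this.2 (key t this.1.1 he)

/-- Level-by-level characterization of Algorithm 1's outputs: `s` is output at the
`n`-th iteration iff `s` is a subset-maximal solution of `F` and exactly `n`
distinct restricted cardinalities of subset-maximal solutions exceed that of `s`. -/
theorem cardmax_iterMax_iff {α : Type*} [DecidableEq α]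
    (R : Finset α) (F : Set (Finset α)) (hF : F.Finite) (n : ℕ) (s : Finset α) :
    s ∈ Cardmax R (iterMax R F n) ↔
      s ∈ Setmax R F ∧
        {k ∈ (fun t => (t ∩ R).card) '' Setmax R F | (s ∩ R).card < k}.ncard = n := by
  induction n generalizing F with
  | zero =>
    constructor
    · intro h
      exact ⟨cardmax_setmax R F s h, by rw [count_of_cardmax R F s h]; simp⟩
    · rintro ⟨h, h0⟩
      by_contra hc
      have := count_step R F hF s h hc
      omega
  | succ n ih =>
    rw [iterMax_succ_step, ih (stepMax R F) (hF.subset fun t ht => ht.1), setmax_step]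
    constructor
    · rintro ⟨⟨h, hc⟩, hn⟩
      exact ⟨h, by rw [count_step R F hF s h hc, hn]⟩
    · rintro ⟨h, hn⟩
      have hc : s ∉ Cardmax R F := by
        intro hc
        rw [count_of_cardmax R F s hc] at hn
        simp at hn
      rw [count_step R F hF s h hc] at hn
      exact ⟨⟨h, hc⟩, by omega⟩
end

section
/- Each subset-maximal solution is output exactly once by Algorithm 1: for any finite family F of finsets of α, any R : Finset α, and every s ∈ Setmax R F, there exists a unique n ∈ ℕ with s ∈ Cardmax R F_n, where (F_n) is the maximization iteration of Algorithm 1 starting from F. -/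
theorem iterMax_anti {α : Type*} [DecidableEq α] (R : Finset α) (F : Set (Finset α)) :
    Antitone (iterMax R F) :=
  antitone_nat_of_succ_le fun _ _ h => h.1

theorem exists_mem_Cardmax {α : Type*} [DecidableEq α] (R : Finset α) (F : Set (Finset α))
    (hF : F.Finite) (hne : F.Nonempty) : ∃ m, m ∈ Cardmax R F := by
  obtain ⟨m, hm, h⟩ := Set.exists_max_image F (fun t => (t ∩ R).card) hF hne
  exact ⟨m, hm, h⟩

/-- Each subset-maximal solution is output exactly once by Algorithm 1. -/
theorem setmax_output_exactly_once {α : Type*} [DecidableEq α]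
    (R : Finset α) (F : Set (Finset α)) (hF : F.Finite)
    (s : Finset α) (hs : s ∈ Setmax R F) :
    ∃! n : ℕ, s ∈ Cardmax R (iterMax R F n) := by
  have hex : ∃ n, s ∈ Cardmax R (iterMax R F n) := by
    by_contra hno
    have hall : ∀ n, s ∈ iterMax R F n := by
      intro n
      induction n with
      | zero => exact hs.1
      | succ n ih =>
        refine ⟨ih, ?_⟩
        rintro ⟨t, ht, hst⟩
        have heq : s ∩ R = t ∩ R := by
          by_contra hne
          exact hs.2 ⟨t, iterMax_anti R F (Nat.zero_le n) ht.1, hst.ssubset_of_ne hne⟩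
        exact hno ⟨n, ih, fun s' hs' => heq ▸ ht.2 s' hs'⟩
    have := iterMax_card R F hF (R.card + 1) s (hall _)
    omega
  have key : ∀ a b, a < b → s ∈ Cardmax R (iterMax R F a) →
      s ∉ Cardmax R (iterMax R F b) := fun a b hab ha hb =>
    (iterMax_anti R F (Nat.succ_le_of_lt hab) hb.1).2 ⟨s, ha, subset_rfl⟩
  obtain ⟨n, hn⟩ := hex
  refine ⟨n, hn, fun m hm => ?_⟩
  rcases lt_trichotomy m n with h | h | h
  · exact absurd hn (key m n h hm)
  · exact h
  · exact absurd hm (key n m h hn)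
end

section
/- Algorithm 1 never discards a subset-maximal solution before outputting it: for any finite family F of finsets of α, any R : Finset α, every s ∈ Setmax R F, and every n ∈ ℕ, one has s ∈ F_n if and only if s ∉ Cardmax R F_j for all j < n, where (F_n) is the maximization iteration of Algorithm 1 starting from F. -/
/-- Algorithm 1 never discards a subset-maximal solution before outputting it:
a subset-maximal solution `s` is still present at stage `n` iff it has not been
output at any earlier stage. -/
theorem setmax_mem_iterMax_iff {α : Type*} [DecidableEq α]
    (R : Finset α) (F : Set (Finset α)) (hF : F.Finite)
    (s : Finset α) (hs : s ∈ Setmax R F) (n : ℕ) :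
    s ∈ iterMax R F n ↔ ∀ j < n, s ∉ Cardmax R (iterMax R F j) := by
  have hsub : ∀ m, iterMax R F m ⊆ F := by
    intro m
    induction m with
    | zero => exact fun x hx => hx
    | succ k ih => exact fun x hx => ih hx.1
  induction n with
  | zero => exact ⟨fun _ j hj => absurd hj (Nat.not_lt_zero j), fun _ => hs.1⟩
  | succ k ih =>
    constructor
    · intro h j hj
      rcases Nat.lt_succ_iff_lt_or_eq.mp hj with hj | rfl
      · exact ih.mp h.1 j hj
      · exact fun hc => h.2 ⟨s, hc, Finset.Subset.refl _⟩
    · intro h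
      have hk : s ∈ iterMax R F k := ih.mpr fun j hj => h j (Nat.lt_succ_of_lt hj)
      refine ⟨hk, ?_⟩
      rintro ⟨t, ht, hst⟩
      rcases hst.eq_or_ssubset with he | hss
      · refine h k (Nat.lt_succ_self k) ⟨hk, ?_⟩
        rw [he]
        exact ht.2
      · exact hs.2 ⟨t, hsub k ht.1, hss⟩
end

section
/- Subset-maximality is preserved under the restriction step of Algorithm 1: for any family F of finsets of α, any R : Finset α, and every n ∈ ℕ, Setmax R F_n ⊆ Setmax R F, where (F_n) is the maximization iteration of Algorithm 1 starting from F; that is, any solution that is subset-maximal within a later-stage family F_n is already subset-maximal within the original family F. -/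
/-- Subset-maximality is preserved under the restriction step of Algorithm 1:
any solution subset-maximal within a later-stage family `F_n` is already
subset-maximal within the original family `F`. -/
theorem setmax_iterMax_subset_setmax {α : Type*} [DecidableEq α]
    (R : Finset α) (F : Set (Finset α)) (n : ℕ) :
    Setmax R (iterMax R F n) ⊆ Setmax R F := by
  induction n with
  | zero => exact fun s hs => hs
  | succ n ih =>
    intro s hs
    apply ih
    obtain ⟨⟨hsF, hsC⟩, hmax⟩ := hs
    refine ⟨hsF, ?_⟩
    rintro ⟨s', hs', hss'⟩
    refine hmax ⟨s', ⟨hs', ?_⟩, hss'⟩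
    rintro ⟨c, hc, hsc⟩
    exact hsC ⟨c, hc, hss'.1.trans hsc⟩
end

section
/- Algorithm 1 applied to admissible sets enumerates exactly the preferred extensions: let F be the family of all admissible finsets of a finite argumentation framework, define F_0 = F and F_{n+1} = {S' ∈ F_n | there is no S ∈ Cardmax F_n with S' ⊆ S}, where Cardmax G = {S ∈ G | for all S' ∈ G, S'.card ≤ S.card}. Then the union over all n ∈ ℕ of Cardmax F_n equals the set of preferred extensions of the framework. -/
/-- A finset `S` of arguments is conflict-free if no argument in `S` attacks
another argument in `S`. -/
def ConflictFree {A : Type*} (att : A → A → Prop) (S : Finset A) : Prop :=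
  ¬ ∃ a ∈ S, ∃ b ∈ S, att a b

/-- An argument `a` is acceptable with respect to `S` if every attacker of `a`
is attacked by some element of `S`. -/
def Acceptable {A : Type*} (att : A → A → Prop) (S : Finset A) (a : A) : Prop :=
  ∀ b, att b a → ∃ c ∈ S, att c b

/-- A finset `S` of arguments is admissible if it is conflict-free and each of
its elements is acceptable with respect to `S`. -/
def Admissible {A : Type*} (att : A → A → Prop) (S : Finset A) : Prop :=
  ConflictFree att S ∧ ∀ a ∈ S, Acceptable att S a

/-- A finset `S` of arguments is a preferred extension if it is a maximal
(w.r.t. set inclusion) admissible set. -/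
def PreferredExt {A : Type*} (att : A → A → Prop) (S : Finset A) : Prop :=
  Admissible att S ∧ ¬ ∃ S', Admissible att S' ∧ S ⊂ S'

/-- Cardinality-maximal members of a family `G` of finsets of arguments. -/
def CardmaxArg {A : Type*} (G : Set (Finset A)) : Set (Finset A) :=
  {S ∈ G | ∀ S' ∈ G, S'.card ≤ S.card}

/-- The maximization iteration of Algorithm 1 starting from the family of all
admissible sets of the framework. -/
def iterAdm {A : Type*} (att : A → A → Prop) : ℕ → Set (Finset A)
  | 0 => {S | Admissible att S}
  | n + 1 => {S' ∈ iterAdm att n | ¬ ∃ S ∈ CardmaxArg (iterAdm att n), S' ⊆ S}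

theorem iterAdm_adm {A : Type*} (att : A → A → Prop) (n : ℕ) (S : Finset A)
    (h : S ∈ iterAdm att n) : Admissible att S := by
  induction n with
  | zero => exact h
  | succ n ih => exact ih h.1

theorem iterAdm_up {A : Type*} (att : A → A → Prop) (n : ℕ) (S T : Finset A)
    (h : S ∈ iterAdm att n) (hT : Admissible att T) (hST : S ⊆ T) : T ∈ iterAdm att n := by
  induction n with
  | zero => exact hT
  | succ n ih =>
    exact ⟨ih h.1, fun ⟨R, hR, hTR⟩ => h.2 ⟨R, hR, hST.trans hTR⟩⟩

theorem iterAdm_card {A : Type*} [Fintype A] (att : A → A → Prop) (n : ℕ) (T : Finset A)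
    (h : T ∈ iterAdm att n) : T.card + n ≤ Fintype.card A := by
  induction n generalizing T with
  | zero => exact Finset.card_le_univ T
  | succ n ih =>
    by_contra hc
    refine h.2 ⟨T, ⟨h.1, fun T' hT' => ?_⟩, Finset.Subset.refl T⟩
    have := ih T' hT'
    omega

/-- Algorithm 1 applied to the admissible sets of a finite argumentation
framework enumerates exactly the preferred extensions. -/
theorem iterAdm_union_cardmax_eq_preferred {A : Type*} [Fintype A] [DecidableEq A]
    (att : A → A → Prop) :
    (⋃ n : ℕ, CardmaxArg (iterAdm att n)) = {S | PreferredExt att S} := by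
  ext S
  simp only [Set.mem_iUnion, Set.mem_setOf_eq]
  constructor
  · rintro ⟨n, hS, hmax⟩
    refine ⟨iterAdm_adm att n S hS, ?_⟩
    rintro ⟨S', hS', hlt⟩
    have h1 := hmax S' (iterAdm_up att n S S' hS hS' hlt.subset)
    have h2 := Finset.card_lt_card hlt
    omega
  · rintro ⟨hS, hmax⟩
    by_contra hc
    have hall : ∀ n, S ∈ iterAdm att n := by
      intro n
      induction n with
      | zero => exact hS
      | succ n ih =>
        refine ⟨ih, ?_⟩
        rintro ⟨R, hR, hSR⟩
        rcases hSR.eq_or_ssubset with rfl | hlt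
        · exact hc ⟨n, hR⟩
        · exact hmax ⟨R, iterAdm_adm att n R hR.1, hlt⟩
    have := iterAdm_card att _ S (hall (Fintype.card A + 1))
    omega
end
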